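/- arXiv:2312.04608 — 2 statements merged into one kernel-verified Lean document; each statement's English description precedes it below -/
import Mathlib

section
/- For every real α with −2 ≤ α ≤ 2, the integral I(α) = ∫₀^∞ ln(1 + α e^{−x} + e^{−2x}) dx equals −(1/2)·(arccos(α/2))² + π²/6. -/
open MeasureTheory in
theorem param_log_pointwise (φ x : ℝ) (hx : 0 < x) :
    HasSum (fun n : ℕ => (-2 * Real.cos (((n : ℝ) + 1) * φ) / ((n : ℝ) + 1)) *
      Real.exp (-((n : ℝ) + 1) * x))
      (Real.log (1 - 2 * Real.cos φ * Real.exp (-x) + Real.exp (-2 * x))) := by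
  set z : ℂ := Complex.exp (((-x : ℝ) : ℂ) + (φ : ℂ) * Complex.I) with hz
  have hre : z.re = Real.exp (-x) * Real.cos φ := by
    rw [hz, Complex.exp_re]; simp
  have him : z.im = Real.exp (-x) * Real.sin φ := by
    rw [hz, Complex.exp_im]; simp
  have hnorm : ‖z‖ < 1 := by
    rw [hz, Complex.norm_exp]; simpa using hx
  have h := (Complex.hasSum_re (Complex.hasSum_taylorSeries_neg_log' hnorm)).mul_left (-2)
  have hE : Real.exp (-2 * x) = Real.exp (-x) ^ 2 := by
    rw [← Real.exp_nat_mul]; congr 1; push_cast; ring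
  convert! h using 1
  · funext n
    have h1 : z ^ (n + 1) / ((n : ℂ) + 1) =
        Complex.exp (((-((n : ℝ) + 1) * x : ℝ) : ℂ) + ((((n : ℝ) + 1) * φ : ℝ) : ℂ) * Complex.I)
          / (((n : ℝ) + 1 : ℝ) : ℂ) := by
      rw [hz, ← Complex.exp_nat_mul]
      push_cast
      congr 2
      ring
    rw [h1, Complex.div_ofReal_re, Complex.exp_re]
    simp only [Complex.add_re, Complex.add_im, Complex.ofReal_re, Complex.ofReal_im,
      Complex.re_ofReal_mul, Complex.im_ofReal_mul, Complex.I_re, Complex.I_im]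
    simp only [mul_zero, mul_one, add_zero, zero_add]
    ring
  · rw [Complex.neg_re, Complex.log_re]
    have h2 : 1 - 2 * Real.cos φ * Real.exp (-x) + Real.exp (-2 * x) = ‖1 - z‖ ^ 2 := by
      rw [Complex.sq_norm, Complex.normSq_apply, hE]
      simp only [Complex.sub_re, Complex.sub_im, Complex.one_re, Complex.one_im, hre, him]
      linear_combination (-Real.exp (-x) ^ 2) * Real.sin_sq_add_cos_sq φ
    rw [h2, Real.log_pow]
    push_cast; ring

theorem cos_series_two (φ : ℝ) (h0 : 0 ≤ φ) (h1 : φ ≤ Real.pi) :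
    HasSum (fun n : ℕ => Real.cos (((n : ℝ) + 1) * φ) / ((n : ℝ) + 1) ^ 2)
      (φ ^ 2 / 4 - Real.pi * φ / 2 + Real.pi ^ 2 / 6) := by
  have hpi := Real.pi_pos
  have h := hasSum_one_div_nat_pow_mul_cos one_ne_zero (x := φ / (2 * Real.pi))
    ⟨by positivity, by rw [div_le_one (by positivity)]; linarith⟩
  rw [← hasSum_nat_add_iff' 1] at h
  convert! h using 1
  · funext n
    have : 2 * Real.pi * ((n + 1 : ℕ) : ℝ) * (φ / (2 * Real.pi)) = ((n : ℝ) + 1) * φ := by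
      push_cast; field_simp
    rw [this]; push_cast; ring
  · have hb : Polynomial.bernoulli 2 = Polynomial.X ^ 2 - Polynomial.X
        + Polynomial.C (6⁻¹ : ℚ) := by
      have e2 : bernoulli 2 = 6⁻¹ := bernoulli_two
      ext i
      rw [Polynomial.coeff_bernoulli]
      rcases i with _ | _ | _ | i
      · simp [e2]
      · simp [Polynomial.coeff_X, Polynomial.coeff_C, Polynomial.coeff_X_pow]
      · simp [Polynomial.coeff_X, Polynomial.coeff_C, Polynomial.coeff_X_pow]
      · simp [Polynomial.coeff_X, Polynomial.coeff_C, Polynomial.coeff_X_pow]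
    simp [hb, Nat.factorial]
    field_simp
    ring

open MeasureTheory in
theorem integral_param_log_eq (α : ℝ) (h1 : -2 ≤ α) (h2 : α ≤ 2) :
    ∫ x in Set.Ioi (0 : ℝ), Real.log (1 + α * Real.exp (-x) + Real.exp (-2 * x)) =
      -(1 / 2) * (Real.arccos (α / 2)) ^ 2 + Real.pi ^ 2 / 6 := by
  set φ : ℝ := Real.pi - Real.arccos (α / 2) with hφ
  have hcos : α = -2 * Real.cos φ := by
    rw [hφ, Real.cos_pi_sub, Real.cos_arccos (by linarith) (by linarith)]; ring
  have hp0 : 0 ≤ φ := by have := Real.arccos_le_pi (α / 2); linarith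
  have hp1 : φ ≤ Real.pi := by have := Real.arccos_nonneg (α / 2); linarith
  let F : ℕ → ℝ → ℝ := fun n x => (-2 * Real.cos (((n : ℝ) + 1) * φ) / ((n : ℝ) + 1)) *
      Real.exp (-((n : ℝ) + 1) * x)
  have hneg (n : ℕ) : -((n : ℝ) + 1) < 0 := by
    have : (0 : ℝ) ≤ n := n.cast_nonneg
    linarith
  have hI (n : ℕ) : ∫ x in Set.Ioi (0 : ℝ), Real.exp (-((n : ℝ) + 1) * x) = 1 / ((n : ℝ) + 1) := by
    rw [integral_exp_mul_Ioi (hneg n), mul_zero, Real.exp_zero, neg_div_neg_eq]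
  have hint (n : ℕ) : Integrable (F n) (volume.restrict (Set.Ioi 0)) :=
    (integrableOn_exp_mul_Ioi (hneg n) 0).const_mul _
  have hsum : Summable fun n => ∫ x in Set.Ioi (0 : ℝ), ‖F n x‖ := by
    have hs : Summable fun n : ℕ => 2 * (1 / ((n + 1 : ℕ) : ℝ) ^ 2) :=
      ((summable_nat_add_iff 1).2 hasSum_zeta_two.summable).mul_left 2
    refine hs.of_nonneg_of_le (fun n => integral_nonneg fun x => norm_nonneg _) (fun n => ?_)
    have hn : (0 : ℝ) < (n : ℝ) + 1 := by linarith [hneg n]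
    simp only [F, norm_mul, Real.norm_eq_abs, Real.abs_exp]
    rw [integral_const_mul, hI, abs_div, abs_mul, abs_of_pos hn]
    have := Real.abs_cos_le_one (((n : ℝ) + 1) * φ)
    have e : |(-2 : ℝ)| = 2 := by norm_num
    rw [e]
    push_cast
    rw [div_mul_div_comm, mul_one, ← sq, mul_one_div]
    gcongr
    linarith
  have hA := hasSum_integral_of_summable_integral_norm hint hsum
  have hB : HasSum (fun n => ∫ x in Set.Ioi (0 : ℝ), F n x)
      (-2 * (φ ^ 2 / 4 - Real.pi * φ / 2 + Real.pi ^ 2 / 6)) := by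
    convert! (cos_series_two φ hp0 hp1).mul_left (-2) using 1
    funext n
    simp only [F]
    rw [integral_const_mul, hI]
    have := hneg n
    have hn : (n : ℝ) + 1 ≠ 0 := by linarith
    field_simp
  have hC : ∫ x in Set.Ioi (0 : ℝ), Real.log (1 + α * Real.exp (-x) + Real.exp (-2 * x)) =
      ∫ x in Set.Ioi (0 : ℝ), ∑' n, F n x := by
    refine setIntegral_congr_fun measurableSet_Ioi fun x hx => ?_
    have := (param_log_pointwise φ x hx).tsum_eq
    simp only [F]
    rw [this, hcos]
    congr 1; ring
  rw [hC, hA.unique hB, hφ]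
  ring
end

section
/- The improper integral ∫₀^∞ ln(1 − 2e^{−x} + e^{−2x}) dx converges and equals −π²/3. -/
theorem integral_log_sq_one_sub_exp_neg :
    MeasureTheory.IntegrableOn
      (fun x : ℝ => Real.log (1 - 2 * Real.exp (-x) + Real.exp (-2 * x))) (Set.Ioi 0) ∧
    ∫ x in Set.Ioi (0 : ℝ), Real.log (1 - 2 * Real.exp (-x) + Real.exp (-2 * x)) =
      -(Real.pi ^ 2 / 3) := by
  have key : ∫ x in Set.Ioi (0 : ℝ), Real.log (1 - 2 * Real.exp (-x) + Real.exp (-2 * x)) =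
      -(Real.pi ^ 2 / 3) := by
    have hneg : ∀ n : ℕ, -((n : ℝ) + 1) < 0 := fun n => by
      have : (0 : ℝ) ≤ n := n.cast_nonneg
      linarith
    let F : ℕ → ℝ → ℝ := fun n x => Real.exp (-((n : ℝ) + 1) * x) * (2 / ((n : ℝ) + 1))
    have hint : ∀ n, MeasureTheory.Integrable (F n)
        (MeasureTheory.volume.restrict (Set.Ioi (0 : ℝ))) := fun n =>
      MeasureTheory.Integrable.mul_const (integrableOn_exp_mul_Ioi (hneg n) 0) _
    have hval : ∀ n, ∫ x in Set.Ioi (0 : ℝ), F n x = 2 * (1 / ((n + 1 : ℕ) : ℝ) ^ 2) := fun n => by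
      have h0 : (n : ℝ) + 1 ≠ 0 := by have := hneg n; linarith
      simp only [F]
      rw [MeasureTheory.integral_mul_const, integral_exp_mul_Ioi (hneg n) 0]
      simp only [mul_zero, Real.exp_zero]
      push_cast
      field_simp
    have hz : HasSum (fun n : ℕ => 2 * (1 / ((n + 1 : ℕ) : ℝ) ^ 2)) (2 * (Real.pi ^ 2 / 6)) := by
      apply HasSum.mul_left
      have := (hasSum_nat_add_iff' (f := fun n : ℕ => (1 : ℝ) / (n : ℝ) ^ 2) 1).2 hasSum_zeta_two
      simpa using this
    have hnorm : ∀ n x, ‖F n x‖ = F n x := fun n x => by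
      rw [Real.norm_eq_abs, abs_of_nonneg]
      simp only [F]
      positivity
    have hs := MeasureTheory.hasSum_integral_of_summable_integral_norm hint (by
      simp only [hnorm, hval]
      exact hz.summable)
    simp only [hval] at hs
    have he := hs.unique hz
    have hc : ∫ x in Set.Ioi (0 : ℝ), Real.log (1 - 2 * Real.exp (-x) + Real.exp (-2 * x)) =
        ∫ x in Set.Ioi (0 : ℝ), -(∑' n, F n x) := by
      apply MeasureTheory.setIntegral_congr_fun measurableSet_Ioi
      intro x hx
      have hx0 : (0 : ℝ) < x := hx
      have h1 : |Real.exp (-x)| < 1 := by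
        rw [abs_of_pos (Real.exp_pos _), Real.exp_lt_one_iff]
        linarith
      have h2 := (Real.hasSum_pow_div_log_of_abs_lt_one h1).mul_left 2
      have h3 : (fun n : ℕ => 2 * (Real.exp (-x) ^ (n + 1) / ((n : ℝ) + 1))) = fun n => F n x := by
        funext n
        simp only [F]
        rw [← Real.exp_nat_mul]
        push_cast
        rw [show ((n : ℝ) + 1) * -x = -((n : ℝ) + 1) * x by ring]
        ring
      rw [h3] at h2
      have h4 : 1 - 2 * Real.exp (-x) + Real.exp (-2 * x) = (1 - Real.exp (-x)) ^ 2 := by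
        rw [show -2 * x = -x + -x by ring, Real.exp_add]
        ring
      simp only [h2.tsum_eq, h4, Real.log_pow]
      push_cast
      ring
    rw [hc, MeasureTheory.integral_neg, he]
    ring
  refine ⟨?_, key⟩
  by_contra h
  rw [MeasureTheory.integral_undef h] at key
  have := Real.pi_pos
  have : 0 < Real.pi ^ 2 / 3 := by positivity
  linarith
end
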